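/- arXiv:1206.6731 — 2 statements merged into one kernel-verified Lean document; each statement's English description precedes it below -/
import Mathlib

section
/- If m ∈ G(I^k), s ∈ set(m), and x_s·m/x_{min(m)} ⪰ v^k, then the monomial x_s·m/x_{min(m)} belongs to G(I^k). -/
open MvPolynomial Finset

/-- A monomial in `n` variables, recorded by its exponent vector
(index `i : Fin n` corresponds to the variable `x_{i+1}` of the paper). -/
abbrev Mon (n : ℕ) := Fin n →₀ ℕ

/-- The exponent vector of the single variable `x_{j+1}` (`0`-indexed `j`). -/
noncomputable def sing (n j : ℕ) : Mon n :=
  Finsupp.onFinset Finset.univ (fun i => if (i : ℕ) = j then 1 else 0)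
    (fun a _ => Finset.mem_univ a)

/-- Total degree of a monomial. -/
def deg {n : ℕ} (m : Mon n) : ℕ := m.sum fun _ e => e

/-- `m₁ <_lex m₂` for the lexicographic order with `x_1 > x_2 > ⋯ > x_n`. -/
def lexLT {n : ℕ} (m₁ m₂ : Mon n) : Prop :=
  ∃ i : Fin n, (∀ j : Fin n, j < i → m₁ j = m₂ j) ∧ m₁ i < m₂ i

def lexLE {n : ℕ} (m₁ m₂ : Mon n) : Prop := m₁ = m₂ ∨ lexLT m₁ m₂

/-- `m₁ <_revlex m₂` : the increasing reverse lexicographic order. -/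
def revLT {n : ℕ} (m₁ m₂ : Mon n) : Prop :=
  ∃ s : Fin n, (∀ i : Fin n, s < i → m₁ i = m₂ i) ∧ m₂ s < m₁ s

def revLE {n : ℕ} (m₁ m₂ : Mon n) : Prop := m₁ = m₂ ∨ revLT m₁ m₂

/-- `min(m)`: the (0-indexed) smallest index in the support of `m`. -/
noncomputable def minIdx {n : ℕ} (m : Mon n) : ℕ := sInf {j : ℕ | ∃ h : j < n, m ⟨j, h⟩ ≠ 0}

/-- `m̄`: the part of `m` supported in the variables `x_1, …, x_l`
(0-indexed: indices `< l`). -/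
noncomputable def lowPart {n : ℕ} (l : ℕ) (m : Mon n) : Mon n :=
  m.filter fun i => (i : ℕ) < l

/-- `m̃`: the part of `m` supported in the variables `x_{l+1}, …, x_n`
(0-indexed: indices `≥ l`). -/
noncomputable def highPart {n : ℕ} (l : ℕ) (m : Mon n) : Mon n :=
  m.filter fun i => l ≤ (i : ℕ)

/-- The exponent vector of `u = x_1 · x_{l+1}^{a_{l+1}} ⋯ x_n^{a_n}`, where
`a j` (for `l ≤ j < n`, 0-indexed) is the exponent of `x_{j+1}`. -/
noncomputable def uVec (n l : ℕ) (a : ℕ → ℕ) : Mon n :=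
  sing n 0 + ∑ j ∈ Finset.Ico l n, a j • sing n j

/-- The exponent vector of `v = x_l · x_n^{d-1}`. -/
noncomputable def vVec (n l d : ℕ) : Mon n :=
  sing n (l - 1) + (d - 1) • sing n (n - 1)

/-- The lexsegment `L(u,v)`: monomials `w` of degree `d` with `u ≥_lex w ≥_lex v`. -/
def lexSeg (n l d : ℕ) (a : ℕ → ℕ) : Set (Mon n) :=
  { w | deg w = d ∧ lexLE (vVec n l d) w ∧ lexLE w (uVec n l a) }

/-- The lexsegment ideal `I = (L(u,v)) ⊆ K[x_1,…,x_n]`. -/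
noncomputable def lexIdeal (n l d : ℕ) (a : ℕ → ℕ) (K : Type*) [Field K] :
    Ideal (MvPolynomial (Fin n) K) :=
  Ideal.span ((fun w => monomial w (1 : K)) '' lexSeg n l d a)

/-- `G(J)`: the minimal monomial generators of a monomial ideal `J`, i.e.
monomials `m ∈ J` with `m / x_i ∉ J` for every `i ∈ supp m`. -/
def minGens {n : ℕ} (K : Type*) [Field K] (J : Ideal (MvPolynomial (Fin n) K)) :
    Set (Mon n) :=
  { m | monomial m (1 : K) ∈ J ∧
      ∀ i ∈ m.support, monomial (m - Finsupp.single i 1) (1 : K) ∉ J }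

/-- `J_{<revlex m}`: the ideal generated by all `z ∈ G(J)` with `z <_revlex m`. -/
noncomputable def idealBelow {n : ℕ} (K : Type*) [Field K]
    (J : Ideal (MvPolynomial (Fin n) K)) (m : Mon n) : Ideal (MvPolynomial (Fin n) K) :=
  Ideal.span ((fun z => monomial z (1 : K)) '' { z | z ∈ minGens K J ∧ revLT z m })

/-- `set(m) = {j : x_j · m ∈ J_{<revlex m}}` (0-indexed). -/
def setOfGen {n : ℕ} (K : Type*) [Field K] (J : Ideal (MvPolynomial (Fin n) K))
    (m : Mon n) : Set ℕ :=
  { j | j < n ∧ monomial (m + sing n j) (1 : K) ∈ idealBelow K J m }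

/-- The order `≺` on monomials: compare first the degree of the part supported in
`x_1,…,x_l`, then `<_lex`. -/
def precLT {n : ℕ} (l : ℕ) (m₁ m₂ : Mon n) : Prop :=
  deg (lowPart l m₁) < deg (lowPart l m₂) ∨
    (deg (lowPart l m₁) = deg (lowPart l m₂) ∧ lexLT m₁ m₂)

/-- `w = g(z)`: `w` is the `<_revlex`-smallest minimal monomial generator of `J`
dividing the monomial `z` (the value of the decomposition function). -/
def isDecompOf {n : ℕ} (K : Type*) [Field K] (J : Ideal (MvPolynomial (Fin n) K))
    (z w : Mon n) : Prop :=
  w ∈ minGens K J ∧ w ≤ z ∧ ∀ w' ∈ minGens K J, w' ≤ z → revLE w w'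

theorem aux_sing_apply (n j : ℕ) (i : Fin n) : sing n j i = if (i : ℕ) = j then 1 else 0 := rfl

theorem aux_deg_eq {n : ℕ} (m : Mon n) : deg m = ∑ i, m i := by
  unfold deg
  exact Finsupp.sum_fintype _ _ (fun _ => rfl)

theorem aux_low_eq {n : ℕ} (l : ℕ) (m : Mon n) :
    deg (lowPart l m) = ∑ i : Fin n, if (i : ℕ) < l then m i else 0 := by
  rw [aux_deg_eq]
  refine Finset.sum_congr rfl fun i _ => ?_
  simp [lowPart, Finsupp.filter_apply]

theorem aux_deg_add {n : ℕ} (m m' : Mon n) : deg (m + m') = deg m + deg m' := by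
  simp [aux_deg_eq, Finset.sum_add_distrib]

theorem aux_low_add {n : ℕ} (l : ℕ) (m m' : Mon n) :
    deg (lowPart l (m + m')) = deg (lowPart l m) + deg (lowPart l m') := by
  rw [lowPart, Finsupp.filter_add, aux_deg_add]; rfl

theorem aux_low_zero {n : ℕ} (l : ℕ) : deg (lowPart l (0 : Mon n)) = 0 := by
  simp [aux_low_eq]

theorem aux_low_smul {n : ℕ} (l k : ℕ) (m : Mon n) :
    deg (lowPart l (k • m)) = k * deg (lowPart l m) := by
  simp only [aux_low_eq, Finset.mul_sum]
  refine Finset.sum_congr rfl fun i _ => ?_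
  split_ifs <;> simp

theorem aux_deg_sing {n j : ℕ} (hj : j < n) : deg (sing n j) = 1 := by
  rw [aux_deg_eq, Finset.sum_eq_single (⟨j, hj⟩ : Fin n)]
  · simp [aux_sing_apply]
  · intro b _ hb
    rw [aux_sing_apply, if_neg]
    intro h; exact hb (Fin.ext h)
  · simp

theorem aux_low_sing {n j l : ℕ} (hj : j < n) :
    deg (lowPart l (sing n j)) = if j < l then 1 else 0 := by
  rw [aux_low_eq, Finset.sum_eq_single (⟨j, hj⟩ : Fin n)]
  · simp [aux_sing_apply]
  · intro b _ hb
    rw [aux_sing_apply, if_neg (fun h => hb (Fin.ext h))]; simp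
  · simp

theorem aux_low_pos {n l : ℕ} {m : Mon n} (h : 1 ≤ deg (lowPart l m)) :
    ∃ i : Fin n, (i : ℕ) < l ∧ 1 ≤ m i := by
  by_contra! hc
  rw [aux_low_eq, Finset.sum_eq_zero] at h
  · omega
  · intro i _
    split_ifs with hi
    · have := hc i hi; omega
    · rfl

theorem aux_low_ge {n l : ℕ} {m : Mon n} (i : Fin n) (hi : (i : ℕ) < l) :
    m i ≤ deg (lowPart l m) := by
  rw [aux_low_eq]
  have := Finset.single_le_sum (f := fun i : Fin n => if (i : ℕ) < l then m i else 0)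
    (fun _ _ => Nat.zero_le _) (Finset.mem_univ i)
  simpa [hi] using this

theorem aux_v_apply {n l d : ℕ} (i : Fin n) :
    vVec n l d i = (if (i : ℕ) = l - 1 then 1 else 0) +
      (if (i : ℕ) = n - 1 then d - 1 else 0) := by
  simp [vVec, aux_sing_apply]

theorem aux_u_apply {n l : ℕ} {a : ℕ → ℕ} (i : Fin n) :
    uVec n l a i = (if (i : ℕ) = 0 then 1 else 0) + (if l ≤ (i : ℕ) then a i else 0) := by
  have : (∑ j ∈ Finset.Ico l n, a j • sing n j) i = if l ≤ (i : ℕ) then a i else 0 := by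
    rw [Finsupp.finsetSum_apply]
    simp [aux_sing_apply]
  rw [uVec, Finsupp.add_apply, this, aux_sing_apply]

theorem aux_deg_v {n l d : ℕ} (hd : 2 ≤ d) (hl2 : 2 ≤ l) (hln : l ≤ n - 1) :
    deg (vVec n l d) = d := by
  have h1 : deg ((d - 1) • sing n (n - 1)) = (d - 1) * deg (sing n (n - 1)) := by
    simp [aux_deg_eq, Finset.mul_sum]
  rw [vVec, aux_deg_add, h1, aux_deg_sing (by omega), aux_deg_sing (by omega)]; omega

theorem aux_low_v {n l d : ℕ} (hl2 : 2 ≤ l) (hln : l ≤ n - 1) :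
    deg (lowPart l (vVec n l d)) = 1 := by
  rw [vVec, aux_low_add, aux_low_smul, aux_low_sing (by omega), aux_low_sing (by omega),
    if_pos (by omega), if_neg (by omega), mul_zero, add_zero]

theorem aux_low_u {n l : ℕ} {a : ℕ → ℕ} (hl2 : 2 ≤ l) (hln : l ≤ n - 1) :
    deg (lowPart l (uVec n l a)) = 1 := by
  rw [← aux_low_sing (n := n) (j := 0) (l := l) (by omega) |>.trans (if_pos (by omega)),
    aux_low_eq, aux_low_eq]
  refine Finset.sum_congr rfl fun i _ => ?_
  split_ifs with hi
  · rw [aux_u_apply, aux_sing_apply, if_neg (by omega : ¬ l ≤ (i : ℕ)), add_zero]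
  · rfl

theorem aux_lex_total {n : ℕ} (m m' : Mon n) : lexLE m m' ∨ lexLT m' m := by
  by_cases h : m = m'
  · exact Or.inl (Or.inl h)
  · have hne : (Finset.univ.filter fun i : Fin n => m i ≠ m' i).Nonempty := by
      by_contra hc
      apply h
      ext i
      by_contra hi
      exact hc ⟨i, by simp [hi]⟩
    obtain ⟨i, hi, hmin⟩ := Finset.exists_min_image _ (fun i => i) hne
    have hi' : m i ≠ m' i := by simpa using hi
    have hj : ∀ j : Fin n, j < i → m j = m' j := by
      intro j hj
      by_contra hc
      exact absurd (hmin j (by simp [hc])) (not_le.mpr hj)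
    rcases lt_or_gt_of_ne hi' with h1 | h1
    · exact Or.inl (Or.inr ⟨i, hj, h1⟩)
    · exact Or.inr ⟨i, fun j hji => (hj j hji).symm, h1⟩

/-- Monomials of degree `d` without `x_1` and with some variable among `x_2..x_l` lie in `L(u,v)`. -/
theorem aux_mem_seg {n l d : ℕ} {a : ℕ → ℕ} (hd : 2 ≤ d) (hl2 : 2 ≤ l) (hln : l ≤ n - 1)
    {w : Mon n} (hdeg : deg w = d) (h0 : w ⟨0, by omega⟩ = 0)
    (hlow : 1 ≤ deg (lowPart l w)) : w ∈ lexSeg n l d a := by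
  refine ⟨hdeg, ?_, Or.inr ⟨⟨0, by omega⟩, ?_, ?_⟩⟩
  · rcases aux_lex_total (vVec n l d) w with h | ⟨i, hj, hi⟩
    · exact h
    · exfalso
      rw [aux_v_apply] at hi
      by_cases h1 : (i : ℕ) = l - 1
      · obtain ⟨j, hjl, hj1⟩ := aux_low_pos hlow
        rw [if_pos h1, if_neg (by omega)] at hi
        rcases lt_trichotomy j i with h | h | h
        · have := hj j h
          rw [aux_v_apply, if_neg, if_neg] at this
          · omega
          · have : (j : ℕ) < i := h
            omega
          · have : (j : ℕ) < i := h
            omega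
        · subst h; omega
        · have : (i : ℕ) < j := h
          omega
      · by_cases h2 : (i : ℕ) = n - 1
        · have hlt : deg w < deg (vVec n l d) := by
            rw [aux_deg_eq, aux_deg_eq]
            refine Finset.sum_lt_sum (fun j _ => ?_) ⟨i, Finset.mem_univ _, ?_⟩
            · rcases lt_or_eq_of_le (show j ≤ i by
                have := j.2
                exact Fin.le_def.mpr (by omega)) with h | h
              · exact (hj j h).le
              · subst h; rw [aux_v_apply]; exact hi.le
            · rw [aux_v_apply]; exact hi
          rw [aux_deg_v hd hl2 hln] at hlt
          omega
        · rw [if_neg h1, if_neg h2] at hi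
          omega
  · intro j hj
    have : (j : ℕ) < 0 := hj
    omega
  · rw [h0, aux_u_apply]; simp

theorem aux_seg_low {n l d : ℕ} {a : ℕ → ℕ} (hl2 : 2 ≤ l) (hln : l ≤ n - 1)
    {w : Mon n} (hw : w ∈ lexSeg n l d a) : 1 ≤ deg (lowPart l w) := by
  obtain ⟨_, h | ⟨i, hj, hi⟩, _⟩ := hw
  · rw [← h, aux_low_v hl2 hln]
  · by_cases h : (i : ℕ) < l
    · have := aux_low_ge (m := w) i h
      omega
    · have h1 := hj ⟨l - 1, by omega⟩ (Fin.lt_def.mpr (by simp; omega))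
      have h2 := aux_low_ge (l := l) (m := w) ⟨l - 1, by omega⟩ (by simp; omega)
      rw [aux_v_apply] at h1
      simp at h1
      omega

theorem aux_seg_zero {n l d : ℕ} {a : ℕ → ℕ} (hl2 : 2 ≤ l) (hln : l ≤ n - 1)
    {w : Mon n} (hw : w ∈ lexSeg n l d a) :
    w ⟨0, by omega⟩ = 0 ∨ (w ⟨0, by omega⟩ = 1 ∧ deg (lowPart l w) = 1) := by
  obtain ⟨_, _, h | ⟨i, hj, hi⟩⟩ := hw
  · right
    rw [h, aux_low_u hl2 hln, aux_u_apply]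
    refine ⟨?_, rfl⟩
    rw [if_pos rfl, if_neg (by simp; omega)]
  · rw [aux_u_apply] at hi
    by_cases h0 : (i : ℕ) = 0
    · left
      rw [if_pos h0, if_neg (by omega)] at hi
      have : i = ⟨0, by omega⟩ := Fin.ext h0
      rw [← this]; omega
    · rw [if_neg h0] at hi
      by_cases hil : l ≤ (i : ℕ)
      · right
        constructor
        · rw [hj ⟨0, by omega⟩ (Fin.lt_def.mpr (by simp; omega)), aux_u_apply, if_pos rfl,
            if_neg (by simp; omega)]
        · rw [← aux_low_u (n := n) (a := a) hl2 hln, aux_low_eq, aux_low_eq]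
          refine Finset.sum_congr rfl fun j _ => ?_
          split_ifs with hjl
          · exact hj j (Fin.lt_def.mpr (by omega))
          · rfl
      · rw [if_neg hil] at hi; omega

/-- The set of sums of `k` elements of `S`. -/
def auxSums {n : ℕ} (S : Set (Mon n)) (k : ℕ) : Set (Mon n) :=
  { m | ∃ M : Multiset (Mon n), M.card = k ∧ (∀ w ∈ M, w ∈ S) ∧ M.sum = m }

theorem aux_span_pow {n : ℕ} (K : Type*) [Field K] (S : Set (Mon n)) (k : ℕ) :
    (Ideal.span ((fun w => monomial w (1 : K)) '' S)) ^ k =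
      Ideal.span ((fun w => monomial w (1 : K)) '' auxSums S k) := by
  induction k with
  | zero =>
    rw [pow_zero, Ideal.one_eq_top, eq_comm, Ideal.eq_top_iff_one]
    refine Ideal.subset_span ⟨0, ⟨0, ?_⟩, rfl⟩
    simp
  | succ k ih =>
    rw [pow_succ, ih, Ideal.span_mul_span']
    congr 1
    ext p
    constructor
    · rintro ⟨_, ⟨x, ⟨M, hM, hMS, rfl⟩, rfl⟩, _, ⟨y, hy, rfl⟩, rfl⟩
      refine ⟨y + M.sum, ⟨y ::ₘ M, ?_, ?_, ?_⟩, ?_⟩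
      · simp [hM]
      · intro w hw
        rcases Multiset.mem_cons.mp hw with h | h
        · rw [h]; exact hy
        · exact hMS w h
      · simp
      · simp [monomial_mul, add_comm]
    · rintro ⟨_, ⟨M, hM, hMS, rfl⟩, rfl⟩
      obtain ⟨y, hyM⟩ := Multiset.card_pos_iff_exists_mem.mp (show 0 < M.card by omega)
      obtain ⟨M', rfl⟩ := Multiset.exists_cons_of_mem hyM
      refine ⟨_, ⟨M'.sum, ⟨M', ?_, ?_, rfl⟩, rfl⟩, _, ⟨y, hMS y hyM, rfl⟩, ?_⟩
      · simpa using hM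
      · intro w hw; exact hMS w (Multiset.mem_cons_of_mem hw)
      · simp [monomial_mul, add_comm]

theorem aux_mem_span {n : ℕ} (K : Type*) [Field K] (S : Set (Mon n)) (m : Mon n) :
    monomial m (1 : K) ∈ Ideal.span ((fun w => monomial w (1 : K)) '' S) ↔ ∃ z ∈ S, z ≤ m := by
  rw [mem_ideal_span_monomial_image]
  simp [support_monomial]

theorem aux_sums_deg {n d : ℕ} {S : Set (Mon n)} (hS : ∀ w ∈ S, deg w = d) {M : Multiset (Mon n)}
    (h : ∀ w ∈ M, w ∈ S) : deg M.sum = M.card * d := by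
  induction M using Multiset.induction with
  | empty => simp [aux_deg_eq]
  | cons y M ih =>
    rw [Multiset.sum_cons, aux_deg_add, ih fun w hw => h w (Multiset.mem_cons_of_mem hw),
      hS y (h y (Multiset.mem_cons_self _ _)), Multiset.card_cons]
    ring

theorem aux_minGens {n d : ℕ} (K : Type*) [Field K] {S : Set (Mon n)} (hS : ∀ w ∈ S, deg w = d)
    (k : ℕ) : minGens K ((Ideal.span ((fun w => monomial w (1 : K)) '' S)) ^ k) = auxSums S k := by
  rw [aux_span_pow]
  ext m
  simp only [minGens, Set.mem_setOf_eq, aux_mem_span]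
  constructor
  · rintro ⟨⟨z, hz, hzm⟩, h2⟩
    have : z = m := by
      by_contra hne
      obtain ⟨i, hi⟩ : ∃ i, z i ≠ m i := by
        by_contra! hc
        exact hne (Finsupp.ext hc)
      have hle := hzm i
      refine h2 i (by rw [Finsupp.mem_support_iff]; omega) ⟨z, hz, fun j => ?_⟩
      have := hzm j
      rw [Finsupp.tsub_apply, Finsupp.single_apply]
      split_ifs with h
      · subst h; omega
      · simpa using this
    exact this ▸ hz
  · intro hm
    refine ⟨⟨m, hm, le_rfl⟩, ?_⟩
    rintro i hi ⟨z, ⟨M, hM, hMS, rfl⟩, hz⟩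
    obtain ⟨M', hM', hMS', rfl⟩ := hm
    have h1 := aux_sums_deg hS hMS
    have h2 := aux_sums_deg hS hMS'
    have h3 : deg M.sum < deg M'.sum := by
      rw [aux_deg_eq, aux_deg_eq]
      refine Finset.sum_lt_sum (fun j _ => ?_) ⟨i, Finset.mem_univ _, ?_⟩
      · exact (hz j).trans (by simp)
      · have h4 := hz i
        rw [Finsupp.mem_support_iff] at hi
        rw [Finsupp.tsub_apply, Finsupp.single_eq_same] at h4
        omega
    rw [h1, h2, hM, hM'] at h3
    omega

theorem aux_low_sum_le {n l : ℕ} {M : Multiset (Mon n)} (h : ∀ w ∈ M, deg (lowPart l w) ≤ 1) :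
    deg (lowPart l M.sum) ≤ M.card := by
  induction M using Multiset.induction with
  | empty => simp [aux_low_zero]
  | cons y M ih =>
    have h1 := ih fun w hw => h w (Multiset.mem_cons_of_mem hw)
    have h2 := h y (Multiset.mem_cons_self _ _)
    rw [Multiset.sum_cons, aux_low_add, Multiset.card_cons]
    omega

theorem aux_exists_split {n : ℕ} {w : Mon n} (i : Fin n) (h : 1 ≤ w i) :
    ∃ r, w = r + sing n i := by
  refine ⟨w - sing n i, (tsub_add_cancel_of_le ?_).symm⟩
  intro j
  rw [aux_sing_apply]
  split_ifs with hj
  · rw [Fin.ext hj]; exact h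
  · exact Nat.zero_le _

theorem aux_mem_sum {n : ℕ} {M : Multiset (Mon n)} (i : Fin n) (h : M.sum i ≠ 0) :
    ∃ w ∈ M, 1 ≤ w i := by
  induction M using Multiset.induction with
  | empty => simp at h
  | cons y M ih =>
    by_cases hy : 1 ≤ y i
    · exact ⟨y, Multiset.mem_cons_self _ _, hy⟩
    · obtain ⟨w, hw, hwi⟩ := ih (by
        rw [Multiset.sum_cons, Finsupp.add_apply] at h
        omega)
      exact ⟨w, Multiset.mem_cons_of_mem hw, hwi⟩

theorem aux_zero_not_set {n d : ℕ} (K : Type*) [Field K] {S : Set (Mon n)}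
    (hS : ∀ w ∈ S, deg w = d) (k : ℕ) {m : Mon n} (hm : m ∈ auxSums S k)
    (h : 0 ∈ setOfGen K ((Ideal.span ((fun w => monomial w (1 : K)) '' S)) ^ k) m) : False := by
  obtain ⟨_, h⟩ := h
  rw [idealBelow, aux_mem_span, aux_minGens K hS] at h
  obtain ⟨z, ⟨⟨M, hM, hMS, rfl⟩, i, hij, hi⟩, hle⟩ := h
  obtain ⟨M', hM', hMS', rfl⟩ := hm
  have h1 := aux_sums_deg hS hMS
  have h2 := aux_sums_deg hS hMS'
  have hi0 : (i : ℕ) = 0 := by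
    by_contra hc
    have := hle i
    rw [Finsupp.add_apply, aux_sing_apply, if_neg hc] at this
    omega
  have h3 : deg M'.sum < deg M.sum := by
    rw [aux_deg_eq, aux_deg_eq]
    refine Finset.sum_lt_sum (fun j _ => ?_) ⟨i, Finset.mem_univ _, hi⟩
    by_cases hj : (j : ℕ) = 0
    · rw [show j = i from Fin.ext (by omega)]; exact hi.le
    · exact (hij j (Fin.lt_def.mpr (by omega))).ge
  rw [h1, h2, hM, hM'] at h3
  omega

/-- If `m ∈ G(I^k)`, `s ∈ set(m)` and `x_s·m/x_{min(m)} ⪰ v^k`, then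
`x_s·m/x_{min(m)} ∈ G(I^k)`. -/
theorem stmt8 (n d l k : ℕ) (K : Type*) [Field K] (a : ℕ → ℕ)
    (hd : 2 ≤ d) (hl2 : 2 ≤ l) (hln : l ≤ n - 1)
    (hsum : ∑ j ∈ Finset.Ico l n, a j = d - 1) (hk : 1 ≤ k) :
    ∀ m ∈ minGens K ((lexIdeal n l d a K) ^ k),
      ∀ s ∈ setOfGen K ((lexIdeal n l d a K) ^ k) m,
        ¬ precLT l (m + sing n s - sing n (minIdx m)) (k • vVec n l d) →
          m + sing n s - sing n (minIdx m) ∈ minGens K ((lexIdeal n l d a K) ^ k) := by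
  intro m hm s hs hprec
  have hS : ∀ w ∈ lexSeg n l d a, deg w = d := fun w hw => hw.1
  unfold lexIdeal at hm hs ⊢
  rw [aux_minGens K hS] at hm ⊢
  have hs0 : s ≠ 0 := by
    rintro rfl
    exact aux_zero_not_set K hS k hm hs
  have hsn : s < n := hs.1
  obtain ⟨M, hM, hMS, rfl⟩ := hm
  have hlow : k ≤ deg (lowPart l (M.sum + sing n s - sing n (minIdx M.sum))) := by
    by_contra hc
    apply hprec
    left
    rw [aux_low_smul, aux_low_v hl2 hln]
    omega
  -- the minimal index
  obtain ⟨y, hy⟩ := Multiset.card_pos_iff_exists_mem.mp (show 0 < M.card by omega)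
  obtain ⟨i₀, hi₀l, hi₀⟩ := aux_low_pos (aux_seg_low hl2 hln (hMS y hy))
  have hle : ∀ w ∈ M, w ≤ M.sum := fun w hw => Multiset.single_le_sum (fun _ _ => zero_le) w hw
  have hne : {j : ℕ | ∃ h : j < n, M.sum ⟨j, h⟩ ≠ 0}.Nonempty :=
    ⟨i₀, i₀.2, by have := hle y hy i₀; simp only [Fin.eta]; omega⟩
  obtain ⟨hpn, hp⟩ := Nat.sInf_mem hne
  change minIdx M.sum < n at hpn
  have hpmin : ∀ j : Fin n, M.sum j ≠ 0 → minIdx M.sum ≤ j := fun j hj => Nat.sInf_le ⟨j.2, hj⟩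
  have hp' : M.sum ⟨minIdx M.sum, hpn⟩ ≠ 0 := hp
  clear hp
  have hpl : minIdx M.sum < l :=
    lt_of_le_of_lt (hpmin i₀ (by have := hle y hy i₀; omega)) hi₀l
  generalize minIdx M.sum = p at *
  clear hi₀ hi₀l hne hy y
  obtain ⟨w, hwM, hwp⟩ := aux_mem_sum _ hp'
  obtain ⟨r, hr⟩ := aux_exists_split _ hwp
  simp only at hr
  obtain ⟨M', rfl⟩ := Multiset.exists_cons_of_mem hwM
  have hwS := hMS w hwM
  have hM'S : ∀ z ∈ M', z ∈ lexSeg n l d a := fun z hz => hMS z (Multiset.mem_cons_of_mem hz)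
  have hEq : (w ::ₘ M').sum + sing n s - sing n p = r + sing n s + M'.sum := by
    rw [Multiset.sum_cons, hr]
    rw [show r + sing n p + M'.sum + sing n s = r + sing n s + M'.sum + sing n p by abel]
    exact add_tsub_cancel_right _ _
  rw [hEq] at hlow ⊢
  have hn0 : 0 < n := by omega
  -- r has no x_1
  have hr0 : r ⟨0, hn0⟩ = 0 := by
    have h1 := aux_seg_zero hl2 hln hwS
    by_cases hp0 : p = 0
    · have h2 : w ⟨0, hn0⟩ = r ⟨0, hn0⟩ + 1 := by rw [hr]; simp [aux_sing_apply, hp0]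
      rcases h1 with h1 | ⟨h1, _⟩ <;> omega
    · have h3 : (w ::ₘ M').sum ⟨0, hn0⟩ = 0 := by
        by_contra hc
        have := hpmin _ hc
        simp at this
        omega
      have h4 := hle w hwM ⟨0, hn0⟩
      have h5 : r ⟨0, hn0⟩ ≤ w ⟨0, hn0⟩ := by rw [hr]; simp
      omega
  have hdw := hS w hwS
  rw [hr, aux_deg_add, aux_deg_sing hpn] at hdw
  have hsing0 : ∀ q : ℕ, q ≠ 0 → sing n q ⟨0, hn0⟩ = 0 := by
    intro q hq
    rw [aux_sing_apply, if_neg]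
    exact fun h => hq h.symm
  rw [Multiset.card_cons] at hM
  by_cases hc : 1 ≤ deg (lowPart l (r + sing n s))
  · refine ⟨(r + sing n s) ::ₘ M', by simpa using hM, ?_, by simp⟩
    intro z hz
    rcases Multiset.mem_cons.mp hz with h | h
    · rw [h]
      refine aux_mem_seg hd hl2 hln ?_ ?_ hc
      · rw [aux_deg_add, aux_deg_sing hsn]; exact hdw
      · rw [Finsupp.add_apply, hr0, hsing0 s hs0]
    · exact hM'S z h
  · rw [aux_low_add] at hlow
    obtain ⟨y, hyM, hy⟩ : ∃ y ∈ M', 2 ≤ deg (lowPart l y) := by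
      by_contra! hcon
      have := aux_low_sum_le (l := l) (M := M') fun w hw => by have := hcon w hw; omega
      omega
    have hyS := hM'S y hyM
    have hy0 : y ⟨0, hn0⟩ = 0 := by
      rcases aux_seg_zero hl2 hln hyS with h | ⟨_, h⟩
      · exact h
      · omega
    obtain ⟨q, hql, hq⟩ := aux_low_pos (l := l) (m := y) (by omega)
    obtain ⟨t, ht⟩ := aux_exists_split _ hq
    have hq0 : (q : ℕ) ≠ 0 := by
      intro h
      rw [show q = ⟨0, hn0⟩ from Fin.ext h] at hq
      omega
    have ht0 : t ⟨0, hn0⟩ = 0 := by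
      have : t ⟨0, hn0⟩ ≤ y ⟨0, hn0⟩ := by rw [ht]; simp
      omega
    have hdy := hS y hyS
    rw [ht, aux_deg_add, aux_deg_sing q.2] at hdy
    rw [ht, aux_low_add, aux_low_sing q.2, if_pos hql] at hy
    obtain ⟨M'', rfl⟩ := Multiset.exists_cons_of_mem hyM
    refine ⟨(r + sing n q) ::ₘ (t + sing n s) ::ₘ M'', by simpa using hM, ?_, ?_⟩
    · intro z hz
      rcases Multiset.mem_cons.mp hz with h | h
      · rw [h]
        refine aux_mem_seg hd hl2 hln ?_ ?_ ?_
        · rw [aux_deg_add, aux_deg_sing q.2]; exact hdw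
        · rw [Finsupp.add_apply, hr0, hsing0 _ hq0]
        · rw [aux_low_add, aux_low_sing q.2, if_pos hql]; omega
      rcases Multiset.mem_cons.mp h with h | h
      · rw [h]
        refine aux_mem_seg hd hl2 hln ?_ ?_ ?_
        · rw [aux_deg_add, aux_deg_sing hsn]; exact hdy
        · rw [Finsupp.add_apply, ht0, hsing0 _ hs0]
        · rw [aux_low_add]; omega
      · exact hM'S z (Multiset.mem_cons_of_mem h)
    · simp only [Multiset.sum_cons, ht]
      abel
end

section
/- If m ∈ G(I^k), s ∈ set(m), and x_s·m/x_{min(m)} ≺ v^k, then the monomial x_s·m/x_{min(m̃)} belongs to G(I^k), where m̃ is the part of m supported in x_{l+1},…,x_n. -/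
open MvPolynomial Finset

/-- Low degree. -/
def lowDeg {n : ℕ} (l : ℕ) (m : Mon n) : ℕ := ∑ i : Fin n, if (i : ℕ) < l then m i else 0

lemma deg_eq {n : ℕ} (m : Mon n) : deg m = ∑ i : Fin n, m i := by
  unfold deg
  exact Finsupp.sum_fintype _ _ (fun _ => rfl)

lemma deg_low {n : ℕ} (l : ℕ) (m : Mon n) : deg (lowPart l m) = lowDeg l m := by
  rw [deg_eq]; unfold lowDeg lowPart
  exact Finset.sum_congr rfl (fun i _ => by rw [Finsupp.filter_apply])

lemma deg_add' {n : ℕ} (a b : Mon n) : deg (a + b) = deg a + deg b := by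
  simp [deg_eq, Finset.sum_add_distrib]

lemma lowDeg_add {n : ℕ} (l : ℕ) (a b : Mon n) :
    lowDeg l (a + b) = lowDeg l a + lowDeg l b := by
  unfold lowDeg
  rw [← Finset.sum_add_distrib]
  exact Finset.sum_congr rfl (fun i _ => by split_ifs <;> simp)

lemma sing_eq {n : ℕ} (j : Fin n) : sing n j = Finsupp.single j 1 := by
  ext i
  simp only [sing, Finsupp.onFinset_apply, Finsupp.single_apply]
  simp only [Fin.ext_iff, eq_comm]

lemma deg_single {n : ℕ} (j : Fin n) : deg (Finsupp.single j 1 : Mon n) = 1 := by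
  simp [deg]

lemma lowDeg_single {n : ℕ} (l : ℕ) (j : Fin n) :
    lowDeg l (Finsupp.single j 1 : Mon n) = if (j : ℕ) < l then 1 else 0 := by
  unfold lowDeg
  rw [Finset.sum_eq_single j]
  · simp
  · intro b _ hb
    simp [Finsupp.single_apply, Ne.symm hb]
  · simp

lemma v_apply {n l d : ℕ} (i : Fin n) : vVec n l d i =
    (if (i : ℕ) = l - 1 then 1 else 0) + (d - 1) * (if (i : ℕ) = n - 1 then 1 else 0) := by
  simp [vVec, sing]

lemma lowDeg_kv {n l d : ℕ} (k : ℕ) (hl : 2 ≤ l) (hln : l ≤ n - 1) :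
    lowDeg l (k • vVec n l d) = k := by
  unfold lowDeg
  rw [Finset.sum_eq_single (⟨l - 1, by omega⟩ : Fin n)]
  · have h1 : l - 1 < l := by omega
    have h2 : l - 1 ≠ n - 1 := by omega
    simp [v_apply, h1, h2]
  · intro b _ hb
    have h1 : (b : ℕ) ≠ l - 1 := fun h => hb (Fin.ext h)
    by_cases h : (b : ℕ) < l
    · have h2 : (b : ℕ) ≠ n - 1 := by omega
      simp [v_apply, h1, h2]
    · simp [h]
  · simp

lemma deg_v {n l d : ℕ} (hd : 2 ≤ d) (hl : 2 ≤ l) (hln : l ≤ n - 1) : deg (vVec n l d) = d := by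
  have e1 := sing_eq (⟨l - 1, by omega⟩ : Fin n)
  have e2 := sing_eq (⟨n - 1, by omega⟩ : Fin n)
  have : ∀ (c : ℕ) (a : Mon n), deg (c • a) = c * deg a := by
    intro c a; simp [deg_eq, Finset.mul_sum]
  unfold vVec
  simp only at e1 e2
  rw [deg_add', this, e1, e2, deg_single, deg_single]; omega

/-- anything of the right degree and low degree is not below a power of `v`. -/
lemma not_lt_v {n l d k : ℕ} (hd : 2 ≤ d) (hl : 2 ≤ l) (hln : l ≤ n - 1) (M : Mon n)
    (hM : deg M = k * d) (hL : k ≤ lowDeg l M) : ¬ lexLT M (k • vVec n l d) := by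
  rintro ⟨i, h1, h2⟩
  have hv : (k • vVec n l d) i ≠ 0 := by omega
  have hdeg : deg (k • vVec n l d) = k * d := by
    have := deg_v (n := n) (l := l) hd hl hln
    have h2 : deg (k • vVec n l d) = k * deg (vVec n l d) := by
      simp [deg_eq, Finset.mul_sum]
    rw [h2, this]
  by_cases hi : (i : ℕ) < l
  · have hlt : lowDeg l M < lowDeg l (k • vVec n l d) := by
      unfold lowDeg
      apply Finset.sum_lt_sum
      · intro j _
        split_ifs with hj
        · rcases lt_trichotomy j i with h | h | h
          · rw [h1 j h]
          · rw [h]; omega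
          · exfalso
            have : (i : ℕ) < j := h
            apply hv
            have a1 : (i : ℕ) ≠ l - 1 := by omega
            have a2 : (i : ℕ) ≠ n - 1 := by omega
            simp [v_apply, a1, a2]
        · exact le_rfl
      · exact ⟨i, Finset.mem_univ _, by simp only [hi, if_true]; exact h2⟩
    rw [lowDeg_kv k hl hln] at hlt
    omega
  · have a1 : (i : ℕ) = n - 1 := by
      by_contra h
      apply hv
      have a1 : (i : ℕ) ≠ l - 1 := by omega
      simp [v_apply, a1, h]
    have : deg M < deg (k • vVec n l d) := by
      rw [deg_eq, deg_eq]
      apply Finset.sum_lt_sum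
      · intro j _
        by_cases h : j = i
        · rw [h]; exact h2.le
        · rw [h1 j]
          have : (j : ℕ) ≠ i := fun h' => h (Fin.ext h')
          have := j.isLt
          show (j : ℕ) < i
          omega
      · exact ⟨i, Finset.mem_univ _, h2⟩
    omega

lemma lex_total {n : ℕ} (f g : Mon n) : lexLE f g ∨ lexLT g f := by
  by_cases h : f = g
  · exact Or.inl (Or.inl h)
  · have hne : ∃ i, f i ≠ g i := by
      by_contra h'
      push Not at h'
      exact h (Finsupp.ext h')
    have hs : (Finset.univ.filter (fun i => f i ≠ g i)).Nonempty := by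
      obtain ⟨i, hi⟩ := hne
      exact ⟨i, by simpa using hi⟩
    have hm := Finset.min'_mem _ hs
    set c := (Finset.univ.filter (fun i => f i ≠ g i)).min' hs with hc
    have hlt : ∀ j, j < c → f j = g j := by
      intro j hj
      by_contra h'
      have := Finset.min'_le (Finset.univ.filter (fun i => f i ≠ g i)) j (by simpa using h')
      exact absurd hj (not_lt.mpr this)
    have hc' : f c ≠ g c := by simpa using hm
    rcases lt_or_gt_of_ne hc' with h1 | h1
    · exact Or.inl (Or.inr ⟨c, hlt, h1⟩)
    · exact Or.inr ⟨c, fun j hj => (hlt j hj).symm, h1⟩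

lemma lex_trans {n : ℕ} {f g h : Mon n} (h1 : lexLT f g) (h2 : lexLE g h) : lexLT f h := by
  rcases h2 with rfl | ⟨j, hj, hj'⟩
  · exact h1
  · obtain ⟨i, hi, hi'⟩ := h1
    rcases lt_trichotomy i j with h | h | h
    · exact ⟨i, fun c hc => (hi c hc).trans (hj c (hc.trans h)), by rw [← hj i h]; exact hi'⟩
    · subst h
      exact ⟨i, fun c hc => (hi c hc).trans (hj c hc), hi'.trans hj'⟩
    · exact ⟨j, fun c hc => (hi c (hc.trans h)).trans (hj c hc), by rw [hi j h]; exact hj'⟩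

lemma seg_low {n l d : ℕ} {a : ℕ → ℕ} (hl : 2 ≤ l) (hln : l ≤ n - 1)
    {g : Mon n} (hg : g ∈ lexSeg n l d a) : 1 ≤ lowDeg l g := by
  obtain ⟨_, hv, _⟩ := hg
  have key : ∃ i : Fin n, (i : ℕ) < l ∧ 0 < g i := by
    rcases hv with rfl | ⟨i, h1, h2⟩
    · exact ⟨⟨l - 1, by omega⟩, by simp only; omega, by simp [v_apply]⟩
    · by_cases hi : (i : ℕ) < l
      · exact ⟨i, hi, by omega⟩
      · refine ⟨⟨l - 1, by omega⟩, by simp only; omega, ?_⟩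
        rw [← h1 ⟨l - 1, by omega⟩ (by show l - 1 < (i : ℕ); omega)]
        simp [v_apply]
  obtain ⟨i, hi, hp⟩ := key
  unfold lowDeg
  have := Finset.single_le_sum (f := fun i : Fin n => if (i : ℕ) < l then g i else 0)
    (fun _ _ => Nat.zero_le _) (Finset.mem_univ i)
  simp only [hi, if_true] at this
  omega

lemma seg_move {n l d : ℕ} {a : ℕ → ℕ} (hd : 2 ≤ d) (hl : 2 ≤ l) (hln : l ≤ n - 1)
    {r : Mon n} {q s : Fin n} (hq : l ≤ (q : ℕ)) (hqs : q < s)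
    (hg : r + Finsupp.single q 1 ∈ lexSeg n l d a) :
    r + Finsupp.single s 1 ∈ lexSeg n l d a := by
  have hlow := seg_low hl hln hg
  obtain ⟨h1, h2, h3⟩ := hg
  have hdeg : deg (r + Finsupp.single s 1) = d := by
    rw [← h1, deg_add', deg_add', deg_single, deg_single]
  have hs : (q : ℕ) < s := hqs
  refine ⟨hdeg, ?_, ?_⟩
  · rcases lex_total (vVec n l d) (r + Finsupp.single s 1) with h | h
    · exact h
    · exfalso
      refine not_lt_v (k := 1) hd hl hln _ (by simpa using hdeg) ?_ (by simpa using h)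
      rw [lowDeg_add, lowDeg_single] at hlow ⊢
      rw [if_neg (by omega)] at hlow
      omega
  · refine Or.inr (lex_trans ⟨q, ?_, ?_⟩ h3)
    · intro j hj
      simp [Finsupp.single_apply, hj.ne', (hj.trans hqs).ne']
    · simp [Finsupp.single_apply, hqs.ne']

/-- `k`-fold sums of elements of `S`. -/
def prodSet {n : ℕ} (S : Set (Mon n)) : ℕ → Set (Mon n)
  | 0 => {0}
  | k + 1 => {w | ∃ a ∈ prodSet S k, ∃ b ∈ S, w = a + b}

lemma pow_eq {n : ℕ} (K : Type*) [Field K] (S : Set (Mon n)) (k : ℕ) :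
    (Ideal.span ((fun w => monomial w (1 : K)) '' S)) ^ k =
      Ideal.span ((fun w => monomial w (1 : K)) '' prodSet S k) := by
  induction k with
  | zero =>
    simp only [pow_zero, prodSet, Set.image_singleton]
    rw [Ideal.one_eq_top, eq_comm, Ideal.eq_top_iff_one]
    exact Ideal.subset_span rfl
  | succ k ih =>
    rw [pow_succ, ih, Ideal.span_mul_span']
    congr 1
    ext f
    simp only [Set.mem_mul, Set.mem_image, prodSet, Set.mem_setOf_eq]
    constructor
    · rintro ⟨_, ⟨a, ha, rfl⟩, _, ⟨b, hb, rfl⟩, rfl⟩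
      exact ⟨a + b, ⟨a, ha, b, hb, rfl⟩, by simp [monomial_mul]⟩
    · rintro ⟨_, ⟨a, ha, b, hb, rfl⟩, rfl⟩
      exact ⟨_, ⟨a, ha, rfl⟩, _, ⟨b, hb, rfl⟩, by simp [monomial_mul]⟩

lemma mem_span_mon {n : ℕ} (K : Type*) [Field K] (S : Set (Mon n)) (m : Mon n) :
    monomial m (1 : K) ∈ Ideal.span ((fun w => monomial w (1 : K)) '' S) ↔
      ∃ w ∈ S, w ≤ m := by
  classical
  rw [mem_ideal_span_monomial_image]
  simp [support_monomial]

lemma prod_deg {n d : ℕ} {S : Set (Mon n)} (hS : ∀ g ∈ S, deg g = d) (k : ℕ) :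
    ∀ w ∈ prodSet S k, deg w = k * d := by
  induction k with
  | zero => rintro w rfl; simp [deg_eq]
  | succ k ih =>
    rintro w ⟨a, ha, b, hb, rfl⟩
    rw [deg_add', ih a ha, hS b hb]; ring

lemma prod_low {n l : ℕ} {S : Set (Mon n)} (hS : ∀ g ∈ S, 1 ≤ lowDeg l g) (k : ℕ) :
    ∀ w ∈ prodSet S k, k ≤ lowDeg l w := by
  induction k with
  | zero => intro w _; exact Nat.zero_le _
  | succ k ih =>
    rintro w ⟨a, ha, b, hb, rfl⟩
    have := ih a ha
    have := hS b hb
    rw [lowDeg_add]; omega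

lemma split_single {n : ℕ} (a : Mon n) (q : Fin n) (h : a q ≠ 0) :
    a - Finsupp.single q 1 + Finsupp.single q 1 = a := by
  apply tsub_add_cancel_of_le
  rw [Finsupp.single_le_iff]; omega

lemma prod_move {n : ℕ} {S : Set (Mon n)} {q s : Fin n}
    (hS : ∀ r, r + Finsupp.single q 1 ∈ S → r + Finsupp.single s 1 ∈ S) (k : ℕ) :
    ∀ r, r + Finsupp.single q 1 ∈ prodSet S k → r + Finsupp.single s 1 ∈ prodSet S k := by
  induction k with
  | zero =>
    intro r hr
    have := DFunLike.congr_fun (Set.mem_singleton_iff.mp hr) q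
    simp at this
  | succ k ih =>
    rintro r ⟨a, ha, b, hb, hab⟩
    by_cases haq : a q = 0
    · have hbq : b q ≠ 0 := by
        have := DFunLike.congr_fun hab q
        simp at this; omega
      rw [← split_single b q hbq] at hb hab
      refine ⟨a, ha, _, hS _ hb, ?_⟩
      rw [← add_assoc] at hab ⊢
      rw [add_right_cancel hab]
    · rw [← split_single a q haq] at ha hab
      refine ⟨_, ih _ ha, b, hb, ?_⟩
      rw [add_right_comm] at hab ⊢
      rw [add_right_cancel hab]

lemma minGens_iff {n d : ℕ} (K : Type*) [Field K] {S : Set (Mon n)} (hS : ∀ g ∈ S, deg g = d)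
    (k : ℕ) (m : Mon n) :
    m ∈ minGens K ((Ideal.span ((fun w => monomial w (1 : K)) '' S)) ^ k) ↔
      m ∈ prodSet S k := by
  rw [pow_eq]
  simp only [minGens, Set.mem_setOf_eq, mem_span_mon]
  constructor
  · rintro ⟨⟨w, hw, hle⟩, h⟩
    by_cases he : w = m
    · exact he ▸ hw
    · exfalso
      have : ∃ i, w i ≠ m i := by
        by_contra h'
        push Not at h'
        exact he (Finsupp.ext h')
      obtain ⟨i, hi⟩ := this
      have hi' := hle i
      refine h i (by simp; omega) ⟨w, hw, ?_⟩
      intro j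
      have hj := hle j
      by_cases hij : i = j
      · subst hij; simp; omega
      · simpa [Finsupp.single_apply, hij] using hj
  · intro hm
    refine ⟨⟨m, hm, le_rfl⟩, ?_⟩
    rintro i hi ⟨w, hw, hle⟩
    have h1 := prod_deg hS k m hm
    have h2 := prod_deg hS k w hw
    have h3 : deg w ≤ deg (m - Finsupp.single i 1) := by
      rw [deg_eq, deg_eq]; exact Finset.sum_le_sum (fun j _ => hle j)
    have h4 := congrArg deg (split_single m i (by simpa using hi))
    rw [deg_add', deg_single] at h4
    omega

lemma minIdx_spec {n : ℕ} (m : Mon n) (t : Fin n) (ht : m t ≠ 0) :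
    ∃ p : Fin n, minIdx m = p ∧ m p ≠ 0 ∧ p ≤ t := by
  have hne : {j : ℕ | ∃ h : j < n, m ⟨j, h⟩ ≠ 0}.Nonempty := ⟨t, t.isLt, ht⟩
  obtain ⟨h, h'⟩ := Nat.sInf_mem hne
  exact ⟨⟨_, h⟩, rfl, h', Nat.sInf_le ⟨t.isLt, ht⟩⟩

theorem stmt10 (n d l k : ℕ) (K : Type*) [Field K] (a : ℕ → ℕ)
    (hd : 2 ≤ d) (hl2 : 2 ≤ l) (hln : l ≤ n - 1)
    (hsum : ∑ j ∈ Finset.Ico l n, a j = d - 1) (hk : 1 ≤ k) :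
    ∀ m ∈ minGens K ((lexIdeal n l d a K) ^ k),
      ∀ s ∈ setOfGen K ((lexIdeal n l d a K) ^ k) m,
        precLT l (m + sing n s - sing n (minIdx m)) (k • vVec n l d) →
          m + sing n s - sing n (minIdx (highPart l m)) ∈
            minGens K ((lexIdeal n l d a K) ^ k) := by
  have hSd : ∀ g ∈ lexSeg n l d a, deg g = d := fun g hg => hg.1
  have hSl : ∀ g ∈ lexSeg n l d a, 1 ≤ lowDeg l g := fun g hg => seg_low hl2 hln hg
  have hG : ∀ m, m ∈ minGens K ((lexIdeal n l d a K) ^ k) ↔ m ∈ prodSet (lexSeg n l d a) k :=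
    fun m => minGens_iff K hSd k m
  intro m hm s hs hprec
  rw [hG] at hm ⊢
  obtain ⟨hsn, hs⟩ := hs
  unfold idealBelow at hs
  rw [mem_span_mon] at hs
  obtain ⟨z, ⟨hz, c, hc1, hc2⟩, hzle⟩ := hs
  rw [hG] at hz
  obtain ⟨s, rfl⟩ : ∃ s' : Fin n, s = s' := ⟨⟨s, hsn⟩, rfl⟩
  rw [sing_eq] at hzle hprec ⊢
  have hcs : c = s := by
    by_contra h
    have := hzle c
    simp [Finsupp.single_apply, Ne.symm h] at this
    omega
  subst hcs
  have hzi : ∀ i, i ≠ c → z i ≤ m i := by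
    intro i hi
    have := hzle i
    simpa [Finsupp.single_apply, Ne.symm hi] using this
  have dm := prod_deg hSd k m hm
  have dz := prod_deg hSd k z hz
  have lm := prod_low hSl k m hm
  have lz := prod_low hSl k z hz
  -- a smaller index where `z` is smaller
  obtain ⟨t, htc, hzt⟩ : ∃ t, t < c ∧ z t < m t := by
    by_contra h
    push Not at h
    have : deg m < deg z := by
      rw [deg_eq, deg_eq]
      apply Finset.sum_lt_sum
      · intro i _
        rcases lt_trichotomy i c with h' | h' | h'
        · exact h i h'
        · rw [h']; exact hc2.le
        · rw [hc1 i h']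
      · exact ⟨c, Finset.mem_univ _, hc2⟩
    omega
  -- the low degree of m
  obtain ⟨p, hp, hmp, -⟩ := minIdx_spec m t (by omega)
  rw [hp, sing_eq] at hprec
  have hM : m + Finsupp.single c 1 - Finsupp.single p 1 + Finsupp.single p 1 =
      m + Finsupp.single c 1 := split_single _ p (by simp; omega)
  set M := m + Finsupp.single c 1 - Finsupp.single p 1 with hMdef
  have e1 := congrArg deg hM
  have e2 := congrArg (lowDeg l) hM
  rw [deg_add', deg_add', deg_single, deg_single] at e1
  rw [lowDeg_add, lowDeg_add, lowDeg_single, lowDeg_single] at e2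
  have hMl : lowDeg l M < k := by
    by_contra hcon
    rcases hprec with h | ⟨_, h⟩
    · rw [deg_low, deg_low, lowDeg_kv k hl2 hln] at h
      exact hcon h
    · exact not_lt_v hd hl2 hln M (by omega) (by omega) h
  have hcl : l ≤ (c : ℕ) := by
    by_contra h
    rw [if_pos (by omega : (c : ℕ) < l)] at e2
    split_ifs at e2 <;> omega
  have hml : lowDeg l m ≤ k := by
    split_ifs at e2 <;> omega
  have htl : l ≤ (t : ℕ) := by
    by_contra h
    have : lowDeg l z < lowDeg l m := by
      unfold lowDeg
      apply Finset.sum_lt_sum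
      · intro i _
        split_ifs with hi
        · exact hzi i (by rintro rfl; omega)
        · exact le_rfl
      · exact ⟨t, Finset.mem_univ _, by
          simp only [(by omega : (t : ℕ) < l), if_true]; exact hzt⟩
    omega
  obtain ⟨q, hq, hmq, hqt⟩ := minIdx_spec (highPart l m) t (by
    simp only [highPart, Finsupp.filter_apply, htl, if_true]; omega)
  have hql : l ≤ (q : ℕ) := by
    by_contra h
    simp [highPart, Finsupp.filter_apply, h] at hmq
  have hmq' : m q ≠ 0 := by
    simpa [highPart, Finsupp.filter_apply, hql] using hmq
  rw [hq, sing_eq]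
  have hfin : m + Finsupp.single c 1 - Finsupp.single q 1 =
      (m - Finsupp.single q 1) + Finsupp.single c 1 := by
    apply tsub_add_eq_add_tsub _ |>.symm
    rw [Finsupp.single_le_iff]; omega
  rw [hfin]
  refine prod_move (fun r hr => seg_move hd hl2 hln hql (lt_of_le_of_lt hqt htc) hr) k _ ?_
  rw [split_single m q hmq']
  exact hm
end
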